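/- arXiv:2410.02197 — 2 statements merged into one kernel-verified Lean document; each statement's English description precedes it below -/
import Mathlib

section
/- Let P be a real skew-symmetric k×k matrix (Pᵀ = −P). Then there exist vectors v₁, …, v_k in ℝ^{2k} such that P_{ij} = v_iᵀ R^≻ v_j for all i, j, where R^≻ is the 2k×2k block-diagonal skew-symmetric matrix with k diagonal blocks J = [[0,−1],[1,0]]. (Expressiveness of the preference representation model, Theorem 4.4.) -/
open Matrix

/-- The `2k × 2k` block-diagonal skew-symmetric operator `R^≻` consisting of `k`
diagonal `2 × 2` blocks `J = [[0, -1], [1, 0]]`. -/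
def Rsucc (k : ℕ) : Matrix (Fin (2 * k)) (Fin (2 * k)) ℝ :=
  Matrix.of fun i j =>
    if i.val / 2 = j.val / 2 then
      if i.val % 2 = 0 ∧ j.val % 2 = 1 then -1
      else if i.val % 2 = 1 ∧ j.val % 2 = 0 then 1
      else 0
    else 0

/-- Coordinates of `ℝ^{2k}` indexed by a block and a position inside it. -/
def blockCoordEquiv (k : ℕ) : Fin k × Fin 2 ≃ Fin (2 * k) :=
  finProdFinEquiv.trans (finCongr (mul_comm k 2))

theorem Rsucc_blockCoordEquiv (k : ℕ) (m n : Fin k) (a b : Fin 2) :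
    Rsucc k (blockCoordEquiv k (m, a)) (blockCoordEquiv k (n, b)) =
      if m = n then !![0, -1; 1, 0] a b else 0 := by
  have hdiv (c : Fin k) (d : Fin 2) : (d.val + 2 * c.val) / 2 = c.val := by omega
  have hmod (c : Fin k) (d : Fin 2) : (d.val + 2 * c.val) % 2 = d.val := by omega
  simp only [Rsucc, blockCoordEquiv, Equiv.trans_apply, finCongr_apply, Matrix.of_apply,
    Fin.val_cast, finProdFinEquiv_apply_val, hdiv, hmod, Fin.val_inj]
  fin_cases a <;> fin_cases b <;> simp

theorem dotProduct_Rsucc_mulVec (k : ℕ) (x y : Fin (2 * k) → ℝ) :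
    x ⬝ᵥ (Rsucc k *ᵥ y) =
      ∑ m, (x (blockCoordEquiv k (m, 1)) * y (blockCoordEquiv k (m, 0)) -
        x (blockCoordEquiv k (m, 0)) * y (blockCoordEquiv k (m, 1))) := by
  simp only [dotProduct, mulVec, ← (blockCoordEquiv k).sum_comp, Fintype.sum_prod_type,
    Rsucc_blockCoordEquiv]
  refine Finset.sum_congr rfl fun m _ => ?_
  simp [Fin.sum_univ_two]
  ring

/-- **Expressiveness of the preference representation model (Theorem 4.4).**
Any real skew-symmetric `k × k` matrix `P` can be written as
`P i j = vᵢᵀ R^≻ vⱼ` for suitable vectors `v₁, …, v_k ∈ ℝ^{2k}`. -/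
theorem expressiveness_real (k : ℕ) (P : Matrix (Fin k) (Fin k) ℝ)
    (hP : Pᵀ = -P) :
    ∃ v : Fin k → (Fin (2 * k) → ℝ),
      ∀ i j, P i j = v i ⬝ᵥ (Rsucc k *ᵥ v j) := by
  refine ⟨fun i c => ![(Pi.single i 1 : Fin k → ℝ) ((blockCoordEquiv k).symm c).1,
    P i ((blockCoordEquiv k).symm c).1 / 2] ((blockCoordEquiv k).symm c).2, fun i j => ?_⟩
  have hij : P j i = -P i j := congrFun (congrFun hP i) j
  simp [dotProduct_Rsucc_mulVec, Finset.sum_sub_distrib, Pi.single_apply, hij]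
  ring
end

section
/- Let P be a real skew-symmetric k×k matrix (Pᵀ = −P). Then there exist complex vectors v₁, …, v_k in ℂ^k such that P_{ij} = Im(⟨v_i, v_j⟩) for all i, j, where ⟨v_i, v_j⟩ = Σ_{l=1}^k conj((v_i)_l)·(v_j)_l is the Hermitian inner product (conjugation on the first argument) and Im denotes the imaginary part. (Expressiveness of complex preference representations, Theorem A.2.) -/
open Matrix

/-- **Expressiveness of complex preference representations (Theorem A.2).**
Any real skew-symmetric `k × k` matrix `P` can be written as
`P i j = Im ⟨vᵢ, vⱼ⟩` for suitable complex vectors `v₁, …, v_k ∈ ℂ^k`, where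
`⟨u, w⟩ = ∑ l, conj (u l) * w l` is the Hermitian inner product (conjugation on
the first argument). -/
theorem expressiveness_complex (k : ℕ) (P : Matrix (Fin k) (Fin k) ℝ)
    (hP : Pᵀ = -P) :
    ∃ v : Fin k → (Fin k → ℂ),
      ∀ i j, P i j = (∑ l, (starRingEnd ℂ) (v i l) * v j l).im := by
  refine ⟨fun i l ↦ ⟨if i = l then 1 else 0, P l i / 2⟩, fun i j ↦ ?_⟩
  have hji : P j i = -P i j := congrFun (congrFun hP i) j
  simp only [Complex.im_sum, Complex.mul_im, Complex.conj_re, Complex.conj_im, ite_mul, one_mul,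
    zero_mul, mul_ite, mul_one, mul_zero, Finset.sum_add_distrib, Finset.sum_ite_eq,
    Finset.mem_univ, if_true]
  rw [hji]
  ring
end
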